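/- Let 0<λ<1 and set γ = ∫₀^{2π}∫₀^{2π} (sin²(s₁/2)+sin²(s₂/2))^{−λ} ds₁ds₂. There exists a constant c > 0 depending only on λ such that for every integer L ≥ 2, | (4π²/L²)·Σ_{(i,j)∈{0,…,L−1}², (i,j)≠(0,0)} (sin²(πi/L)+sin²(πj/L))^{−λ} − γ | ≤ c·L^{2λ−2}; that is, the Riemann sum of the weakly singular kernel over the uniform grid ξ_i = 2πi/L (with the singular term omitted) approximates γ with error O(L^{−(2−2λ)}). -/

import Mathlib

open MeasureTheory Real
open scoped BigOperators

/-- `γ = ∫₀^{2π}∫₀^{2π} (sin²(s₁/2)+sin²(s₂/2))^{-λ} ds₁ ds₂`. -/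
noncomputable def gam (l : ℝ) : ℝ :=
  ∫ s₁ in (0:ℝ)..(2 * π), ∫ s₂ in (0:ℝ)..(2 * π),
    (Real.sin (s₁ / 2) ^ 2 + Real.sin (s₂ / 2) ^ 2) ^ (-l)

/-- The Riemann sum of the weakly singular kernel over the uniform grid
`ξ_i = 2πi/L`, with the singular term `(i,j) = (0,0)` omitted. -/
noncomputable def riemannSumKer (l : ℝ) (L : ℕ) : ℝ :=
  ∑ i ∈ Finset.range L, ∑ j ∈ Finset.range L,
    if (i, j) = (0, 0) then 0
    else (Real.sin (π * i / L) ^ 2 + Real.sin (π * j / L) ^ 2) ^ (-l)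


noncomputable def gK (t s : ℝ) : ℝ := Real.exp (-(t * Real.sin (s / 2) ^ 2))
noncomputable def JK (t : ℝ) : ℝ := ∫ s in (0:ℝ)..(2 * π), gK t s
noncomputable def SK (L : ℕ) (t : ℝ) : ℝ := ∑ i ∈ Finset.range L, gK t (2 * π * i / L)

lemma gK_cont2 : Continuous (fun p : ℝ × ℝ => gK p.1 p.2) := by
  unfold gK; fun_prop

lemma gK_cont (t : ℝ) : Continuous (gK t) := by
  unfold gK; fun_prop

lemma gK_pos (t s : ℝ) : 0 < gK t s := Real.exp_pos _

lemma JK_cont : Continuous JK := by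
  unfold JK
  exact intervalIntegral.continuous_parametric_intervalIntegral_of_continuous' (f := gK) gK_cont2 _ _

lemma JK_nonneg (t : ℝ) : 0 ≤ JK t :=
  intervalIntegral.integral_nonneg (by positivity) (fun s _ => (gK_pos t s).le)

lemma sin_half_sq_lower (s : ℝ) (h0 : 0 ≤ s) (h1 : s ≤ π) :
    s ^ 2 / π ^ 2 ≤ Real.sin (s / 2) ^ 2 := by
  have h := Real.mul_le_sin (x := s / 2) (by linarith) (by linarith)
  have h2 : 2 / π * (s / 2) = s / π := by ring
  rw [h2] at h
  rw [← div_pow]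
  exact pow_le_pow_left₀ (by positivity) h 2

lemma gK_le (t s : ℝ) (ht : 0 ≤ t) (h0 : 0 ≤ s) (h1 : s ≤ 2 * π) :
    gK t s ≤ Real.exp (-(t / π ^ 2) * s ^ 2) + Real.exp (-(t / π ^ 2) * (s - 2 * π) ^ 2) := by
  unfold gK
  rcases le_total s π with h | h
  · have := mul_le_mul_of_nonneg_left (sin_half_sq_lower s h0 h) ht
    have h3 : Real.exp (-(t * Real.sin (s / 2) ^ 2)) ≤ Real.exp (-(t / π ^ 2) * s ^ 2) := by
      apply Real.exp_le_exp.2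
      have e : -(t / π ^ 2) * s ^ 2 = -(t * (s ^ 2 / π ^ 2)) := by ring
      rw [e]; linarith
    linarith [Real.exp_pos (-(t / π ^ 2) * (s - 2 * π) ^ 2)]
  · have := mul_le_mul_of_nonneg_left
      (sin_half_sq_lower (2 * π - s) (by linarith) (by linarith)) ht
    have e2 : Real.sin ((2 * π - s) / 2) = Real.sin (s / 2) := by
      rw [show (2 * π - s) / 2 = π - s / 2 by ring, Real.sin_pi_sub]
    rw [e2] at this
    have h3 : Real.exp (-(t * Real.sin (s / 2) ^ 2)) ≤
        Real.exp (-(t / π ^ 2) * (s - 2 * π) ^ 2) := by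
      apply Real.exp_le_exp.2
      have e : -(t / π ^ 2) * (s - 2 * π) ^ 2 = -(t * ((2 * π - s) ^ 2 / π ^ 2)) := by ring
      rw [e]; linarith
    linarith [Real.exp_pos (-(t / π ^ 2) * s ^ 2)]

/-- bound on the continuous heat-type integral -/
lemma JK_le (t : ℝ) (ht : 0 < t) : JK t ≤ 2 * √(π ^ 3) / √t := by
  have hb : 0 < t / π ^ 2 := by positivity
  have i1 : Integrable (fun s : ℝ => Real.exp (-(t / π ^ 2) * s ^ 2)) := integrable_exp_neg_mul_sq hb
  have i2 : Integrable (fun s : ℝ => Real.exp (-(t / π ^ 2) * (s - 2 * π) ^ 2)) :=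
    i1.comp_sub_right (2 * π)
  have v1 := integral_gaussian (t / π ^ 2)
  have v2 : ∫ s : ℝ, Real.exp (-(t / π ^ 2) * (s - 2 * π) ^ 2) = √(π / (t / π ^ 2)) := by
    rw [← v1]
    exact integral_sub_right_eq_self (fun s : ℝ => Real.exp (-(t / π ^ 2) * s ^ 2)) (2 * π)
  have e : √(π / (t / π ^ 2)) = √(π ^ 3) / √t := by
    rw [← Real.sqrt_div (by positivity)]
    congr 1
    field_simp
  have h2pi : (0:ℝ) ≤ 2 * π := by positivity
  calc JK t ≤ ∫ s in (0:ℝ)..(2 * π), (Real.exp (-(t / π ^ 2) * s ^ 2)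
        + Real.exp (-(t / π ^ 2) * (s - 2 * π) ^ 2)) := by
        apply intervalIntegral.integral_mono_on h2pi ((gK_cont t).intervalIntegrable _ _)
        · exact (i1.add i2).intervalIntegrable
        · intro s hs
          exact gK_le t s ht.le hs.1 hs.2
    _ ≤ ∫ s : ℝ, (Real.exp (-(t / π ^ 2) * s ^ 2)
        + Real.exp (-(t / π ^ 2) * (s - 2 * π) ^ 2)) := by
        rw [intervalIntegral.integral_of_le h2pi]
        apply setIntegral_le_integral (i1.add i2)
        exact Filter.Eventually.of_forall
          (fun s => add_nonneg (Real.exp_pos _).le (Real.exp_pos _).le)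
    _ = 2 * √(π ^ 3) / √t := by
        rw [integral_add i1 i2, v1, v2, e]; ring

lemma JK_le' (t : ℝ) (ht : 0 ≤ t) : JK t ≤ 2 * π := by
  have : JK t ≤ ∫ s in (0:ℝ)..(2 * π), (1:ℝ) := by
    apply intervalIntegral.integral_mono_on (by positivity) ((gK_cont t).intervalIntegrable _ _)
      (by simp)
    intro s _
    exact Real.exp_le_one_iff.2 (by have := mul_nonneg ht (sq_nonneg (Real.sin (s/2))); linarith)
  simpa using this

lemma JK_sq_le (t : ℝ) (ht : 0 < t) : JK t ^ 2 ≤ 4 * π ^ 3 / t := by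
  have h := pow_le_pow_left₀ (JK_nonneg t) (JK_le t ht) 2
  rw [div_pow, mul_pow, Real.sq_sqrt (by positivity), Real.sq_sqrt ht.le] at h
  linarith

/-- trapezoidal rule -/
lemma trap_one (g g' g'' : ℝ → ℝ) (a b : ℝ) (hab : a ≤ b)
    (h1 : ∀ x, HasDerivAt g (g' x) x) (h2 : ∀ x, HasDerivAt g' (g'' x) x)
    (hc : Continuous g'') :
    |(b - a) * (g a + g b) / 2 - ∫ x in a..b, g x| ≤ (b - a) ^ 2 * ∫ x in a..b, |g'' x| := by
  have cg : Continuous g := continuous_iff_continuousAt.2 fun x => (h1 x).continuousAt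
  have key : ∫ x in a..b, ((x - a) * (b - x) / 2 * g'' x + g x) = (b - a) * (g a + g b) / 2 := by
    have hd : ∀ x ∈ Set.uIcc a b, HasDerivAt
        (fun x => (x - a) * (b - x) / 2 * g' x - ((b - x) - (x - a)) / 2 * g x)
        ((x - a) * (b - x) / 2 * g'' x + g x) x := by
      intro x _
      have ha : HasDerivAt (fun x : ℝ => x - a) 1 x := (hasDerivAt_id x).sub_const a
      have hb : HasDerivAt (fun x : ℝ => b - x) (-1) x := (hasDerivAt_id x).const_sub b
      refine ((((ha.mul hb).div_const 2).mul (h2 x)).sub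
        (((hb.sub ha).div_const 2).mul (h1 x))).congr_deriv ?_
      simp only [Pi.mul_apply, Pi.sub_apply]
      ring
    rw [intervalIntegral.integral_eq_sub_of_hasDerivAt hd
      ((by fun_prop : Continuous _).intervalIntegrable _ _)]
    ring
  rw [intervalIntegral.integral_add ((by fun_prop : Continuous _).intervalIntegrable _ _)
    (cg.intervalIntegrable _ _)] at key
  rw [← key, add_sub_cancel_right]
  calc |∫ x in a..b, (x - a) * (b - x) / 2 * g'' x|
      ≤ ∫ x in a..b, |(x - a) * (b - x) / 2 * g'' x| := intervalIntegral.abs_integral_le_integral_abs hab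
    _ ≤ ∫ x in a..b, (b - a) ^ 2 * |g'' x| := by
        apply intervalIntegral.integral_mono_on hab
          ((by fun_prop : Continuous _).intervalIntegrable _ _)
          ((by fun_prop : Continuous _).intervalIntegrable _ _)
        intro x hx
        rw [abs_mul]
        apply mul_le_mul_of_nonneg_right _ (abs_nonneg _)
        have p1 : 0 ≤ x - a := by linarith [hx.1]
        have p2 : 0 ≤ b - x := by linarith [hx.2]
        rw [abs_of_nonneg (by positivity)]
        nlinarith [mul_nonneg p1 p2]
    _ = _ := by rw [intervalIntegral.integral_const_mul]

lemma trap_sum (g g' g'' : ℝ → ℝ) (L : ℕ) (hL : 1 ≤ L)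
    (h1 : ∀ x, HasDerivAt g (g' x) x) (h2 : ∀ x, HasDerivAt g' (g'' x) x)
    (hc : Continuous g'') (hp : g 0 = g (2 * π)) :
    |2 * π / L * ∑ i ∈ Finset.range L, g (2 * π * i / L) - ∫ x in (0:ℝ)..(2 * π), g x|
      ≤ (2 * π / L) ^ 2 * ∫ x in (0:ℝ)..(2 * π), |g'' x| := by
  have cg : Continuous g := continuous_iff_continuousAt.2 fun x => (h1 x).continuousAt
  have hLr : (0:ℝ) < L := by exact_mod_cast hL
  set ξ : ℕ → ℝ := fun i => 2 * π * i / L with hξ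
  have hstep : ∀ i, ξ (i + 1) - ξ i = 2 * π / L := by
    intro i; simp only [hξ]; push_cast; ring
  have x0 : ξ 0 = 0 := by simp [hξ]
  have xL : ξ L = 2 * π := by simp only [hξ]; field_simp
  have A := intervalIntegral.sum_integral_adjacent_intervals (f := g) (μ := volume) (a := ξ) (n := L)
    (fun k _ => cg.intervalIntegrable _ _)
  have B := intervalIntegral.sum_integral_adjacent_intervals (f := fun x => |g'' x|) (μ := volume)
    (a := ξ) (n := L) (fun k _ => hc.abs.intervalIntegrable _ _)
  rw [x0, xL] at A B
  have C : ∑ i ∈ Finset.range L, g (ξ (i + 1)) = ∑ i ∈ Finset.range L, g (ξ i) := by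
    have := Finset.sum_range_sub (fun i => g (ξ i)) L
    rw [Finset.sum_sub_distrib, x0, xL, hp] at this
    linarith
  have D : 2 * π / L * ∑ i ∈ Finset.range L, g (ξ i)
      = ∑ i ∈ Finset.range L, (ξ (i + 1) - ξ i) * (g (ξ i) + g (ξ (i + 1))) / 2 := by
    simp_rw [hstep]
    rw [← Finset.sum_div, ← Finset.mul_sum, Finset.sum_add_distrib, C]; ring
  change |2 * π / L * ∑ i ∈ Finset.range L, g (ξ i) - _| ≤ _
  rw [D, ← A, ← B, ← Finset.sum_sub_distrib, Finset.mul_sum]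
  refine (Finset.abs_sum_le_sum_abs _ _).trans (Finset.sum_le_sum fun i _ => ?_)
  have hle : ξ i ≤ ξ (i + 1) := by
    have := hstep i
    have : 0 ≤ 2 * π / L := by positivity
    linarith
  have := trap_one g g' g'' (ξ i) (ξ (i + 1)) hle h1 h2 hc
  rwa [hstep] at this ⊢

noncomputable def gK1 (t s : ℝ) : ℝ := -(t / 2) * Real.sin s * gK t s
noncomputable def gK2 (t s : ℝ) : ℝ :=
  (-(t / 2) * Real.cos s + (t / 2) ^ 2 * Real.sin s ^ 2) * gK t s

lemma gK_deriv (t s : ℝ) : HasDerivAt (gK t) (gK1 t s) s := by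
  have e : gK t = fun s => Real.exp (-(t / 2) * (1 - Real.cos s)) := by
    funext s
    unfold gK
    rw [Real.sin_sq_eq_half_sub, show 2 * (s / 2) = s by ring]
    congr 1; ring
  unfold gK1
  rw [e]
  have := (((Real.hasDerivAt_cos s).const_sub 1).const_mul (-(t / 2))).exp
  convert this using 1
  ring

lemma gK1_deriv (t s : ℝ) : HasDerivAt (gK1 t) (gK2 t s) s := by
  have := ((Real.hasDerivAt_sin s).const_mul (-(t / 2))).mul (gK_deriv t s)
  refine (this.congr_deriv ?_)
  unfold gK1 gK2
  ring

lemma gK2_cont (t : ℝ) : Continuous (gK2 t) := by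
  unfold gK2
  have := gK_cont t
  fun_prop

lemma gK2_le (t s : ℝ) (ht : 0 ≤ t) : |gK2 t s| ≤ 3 * t * gK (t / 2) s := by
  set u := Real.sin (s / 2) ^ 2 with hu
  have hu0 : 0 ≤ u := sq_nonneg _
  have e1 : gK t s = gK (t / 2) s * gK (t / 2) s := by
    unfold gK; rw [← Real.exp_add]; congr 1; ring
  have p := gK_pos (t / 2) s
  have q : gK (t / 2) s ≤ 1 := Real.exp_le_one_iff.2 (by
    have : 0 ≤ t / 2 * u := by positivity
    linarith)
  have r : t / 2 * u * gK (t / 2) s ≤ 1 := by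
    have h := Real.add_one_le_exp (t / 2 * u)
    have h2 : gK (t / 2) s * Real.exp (t / 2 * u) = 1 := by
      unfold gK; rw [← Real.exp_add]; simp [hu]
    nlinarith
  have hs : Real.sin s ^ 2 ≤ 4 * u := by
    have h := Real.sin_two_mul (s / 2)
    rw [show 2 * (s / 2) = s by ring] at h
    rw [h]
    nlinarith [Real.sin_sq_add_cos_sq (s / 2), sq_nonneg (Real.sin (s/2)), sq_nonneg (Real.cos (s/2)),
      mul_nonneg hu0 hu0]
  have hb : |-(t / 2) * Real.cos s + (t / 2) ^ 2 * Real.sin s ^ 2| ≤ t / 2 + t ^ 2 * u := by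
    refine (abs_add_le _ _).trans ?_
    rw [abs_mul, abs_neg, abs_of_nonneg (by positivity : 0 ≤ t / 2), abs_of_nonneg (by positivity : 0 ≤ (t / 2) ^ 2 * Real.sin s ^ 2)]
    have := mul_le_mul_of_nonneg_left (Real.abs_cos_le_one s) (by positivity : 0 ≤ t / 2)
    have := mul_le_mul_of_nonneg_left hs (by positivity : 0 ≤ (t / 2) ^ 2)
    nlinarith
  unfold gK2
  rw [abs_mul, abs_of_pos (gK_pos t s)]
  refine (mul_le_mul_of_nonneg_right hb (gK_pos t s).le).trans ?_
  rw [e1]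
  have r2 : (t / 2 + t ^ 2 * u) * gK (t / 2) s ≤ 3 * t := by
    have h3 := mul_le_mul_of_nonneg_left r (by positivity : 0 ≤ 2 * t)
    have h4 := mul_le_mul_of_nonneg_left q (by positivity : 0 ≤ t / 2)
    nlinarith
  rw [← mul_assoc]
  exact mul_le_mul_of_nonneg_right r2 p.le

lemma T_sub_J (L : ℕ) (hL : 1 ≤ L) (t : ℝ) (ht : 0 ≤ t) :
    |2 * π / L * SK L t - JK t| ≤ (2 * π / L) ^ 2 * (3 * t * JK (t / 2)) := by
  have hp : gK t 0 = gK t (2 * π) := by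
    unfold gK; rw [show 2 * π / 2 = π by ring]; simp
  refine (trap_sum (gK t) (gK1 t) (gK2 t) L hL (gK_deriv t) (gK1_deriv t) (gK2_cont t) hp).trans ?_
  apply mul_le_mul_of_nonneg_left _ (by positivity)
  unfold JK
  rw [← intervalIntegral.integral_const_mul]
  apply intervalIntegral.integral_mono_on (by positivity)
    ((gK2_cont t).abs.intervalIntegrable _ _)
    (((gK_cont _).const_mul _).intervalIntegrable _ _)
  intro s _
  exact gK2_le t s ht

noncomputable def EK (L : ℕ) (t : ℝ) : ℝ := (2 * π / L) ^ 2 * (SK L t ^ 2 - 1) - JK t ^ 2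

lemma EK_small : ∃ C : ℝ, 0 < C ∧ ∀ L : ℕ, 1 ≤ L → ∀ t : ℝ, 0 < t → t ≤ (L:ℝ) ^ 2 →
    |EK L t| ≤ C * (1 / (L:ℝ) ^ 2) := by
  set c : ℝ := 2 * √(π ^ 3) with hc
  have hc0 : 0 < c := by positivity
  refine ⟨24 * π ^ 2 * c * (2 * c + 24 * π ^ 2 * c) + 4 * π ^ 2, by positivity, ?_⟩
  intro L hL t ht htL
  have hLr : (0:ℝ) < L := by exact_mod_cast hL
  have hJ := JK_le t ht
  have hJ2 := JK_le (t / 2) (by positivity)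
  rw [← hc] at hJ hJ2
  have hst : 0 < √t := Real.sqrt_pos.2 ht
  have hsq : √t * √t = t := Real.mul_self_sqrt ht.le
  have hhalf : √t / 2 ≤ √(t / 2) := by
    apply Real.le_sqrt_of_sq_le
    rw [div_pow, Real.sq_sqrt ht.le]; linarith
  have hJ3 : JK (t / 2) ≤ 2 * c / √t := by
    refine hJ2.trans ?_
    calc c / √(t / 2) ≤ c / (√t / 2) := by gcongr
      _ = 2 * c / √t := by field_simp
  have hT := T_sub_J L hL t ht.le
  set T := 2 * π / L * SK L t with hTdef
  have hT2 : |T - JK t| ≤ 24 * π ^ 2 * c * √t / L ^ 2 := by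
    refine hT.trans ?_
    calc (2 * π / L) ^ 2 * (3 * t * JK (t / 2)) ≤ (2 * π / L) ^ 2 * (3 * t * (2 * c / √t)) := by
          gcongr
      _ = 24 * π ^ 2 * c * √t / L ^ 2 := by
          nth_rewrite 1 [← hsq]
          field_simp
          ring
  have hTJ : |T + JK t| ≤ (2 * c + 24 * π ^ 2 * c) / √t := by
    have h1 : 24 * π ^ 2 * c * √t / L ^ 2 ≤ 24 * π ^ 2 * c / √t := by
      rw [div_le_div_iff₀ (by positivity) hst, mul_assoc, hsq]
      gcongr
    have hT0 : 0 ≤ T := by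
      have : 0 ≤ SK L t := Finset.sum_nonneg fun i _ => (gK_pos _ _).le
      positivity
    rw [abs_of_nonneg (add_nonneg hT0 (JK_nonneg t))]
    have := (abs_le.1 hT2).2
    have e : (2 * c + 24 * π ^ 2 * c) / √t = 2 * (c / √t) + 24 * π ^ 2 * c / √t := by ring
    rw [e]; linarith
  have eE : EK L t = (T - JK t) * (T + JK t) - 4 * π ^ 2 / L ^ 2 := by
    unfold EK; rw [hTdef]; ring
  rw [eE]
  refine (abs_sub _ _).trans ?_
  rw [abs_mul, abs_of_nonneg (by positivity : 0 ≤ 4 * π ^ 2 / (L:ℝ) ^ 2)]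
  calc |T - JK t| * |T + JK t| + 4 * π ^ 2 / (L:ℝ) ^ 2
      ≤ 24 * π ^ 2 * c * √t / L ^ 2 * ((2 * c + 24 * π ^ 2 * c) / √t) + 4 * π ^ 2 / (L:ℝ) ^ 2 := by
        gcongr
    _ = _ := by field_simp

lemma sum_inv_sq_le (n : ℕ) : ∑ i ∈ Finset.range n, 1 / ((i:ℝ) + 1) ^ 2 ≤ 2 - 1 / ((n:ℝ) + 1 / 2) := by
  induction n with
  | zero => norm_num
  | succ k ih =>
    rw [Finset.sum_range_succ]
    have : 1 / ((k:ℝ) + 1) ^ 2 ≤ 1 / ((k:ℝ) + 1 / 2) - 1 / ((k:ℝ) + 1 + 1 / 2) := by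
      rw [div_sub_div _ _ (by positivity) (by positivity),
        div_le_div_iff₀ (by positivity) (by positivity)]
      nlinarith
    push_cast
    linarith

lemma exp_neg_le_inv (x : ℝ) (hx : 0 < x) : Real.exp (-x) ≤ 1 / x := by
  rw [Real.exp_neg, one_div]
  apply inv_anti₀ hx
  linarith [Real.add_one_le_exp x]

lemma SK_bounds (L : ℕ) (hL : 1 ≤ L) (t : ℝ) (ht : 0 < t) :
    1 ≤ SK L t ∧ SK L t ≤ 1 + (L:ℝ) ^ 2 / t := by
  obtain ⟨n, rfl⟩ : ∃ n, L = n + 1 := ⟨L - 1, by omega⟩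
  have h0 : gK t (2 * π * ((0:ℕ):ℝ) / ((n + 1 : ℕ):ℝ)) = 1 := by simp [gK]
  unfold SK
  rw [Finset.sum_range_succ', h0]
  constructor
  · have : 0 ≤ ∑ k ∈ Finset.range n, gK t (2 * π * ((k + 1 : ℕ):ℝ) / ((n + 1 : ℕ):ℝ)) :=
      Finset.sum_nonneg fun i _ => (gK_pos _ _).le
    linarith
  · have hterm : ∀ k ∈ Finset.range n, gK t (2 * π * ((k + 1 : ℕ):ℝ) / ((n + 1 : ℕ):ℝ)) ≤
        ((n + 1 : ℕ):ℝ) ^ 2 / (4 * t) * (1 / ((k:ℝ) + 1) ^ 2 + 1 / (((n - 1 - k : ℕ):ℝ) + 1) ^ 2) := by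
      intro k hk
      have hk' : k < n := Finset.mem_range.1 hk
      have hc : ((n - 1 - k : ℕ):ℝ) = (n:ℝ) - 1 - k := by
        rw [Nat.cast_sub (by omega), Nat.cast_sub (by omega)]; simp
      have hkr : (k:ℝ) + 1 ≤ n := by exact_mod_cast hk'
      have hN : (0:ℝ) < (n:ℝ) + 1 := by positivity
      rw [hc]
      push_cast
      refine (gK_le t _ ht.le (by positivity) ?_).trans ?_
      · rw [div_le_iff₀ hN]
        apply mul_le_mul_of_nonneg_left _ (by positivity)
        linarith
      have e1 : -(t / π ^ 2) * (2 * π * ((k:ℝ) + 1) / ((n:ℝ) + 1)) ^ 2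
          = -(4 * t * ((k:ℝ) + 1) ^ 2 / ((n:ℝ) + 1) ^ 2) := by
        field_simp; ring
      have e2 : -(t / π ^ 2) * (2 * π * ((k:ℝ) + 1) / ((n:ℝ) + 1) - 2 * π) ^ 2
          = -(4 * t * ((n:ℝ) - 1 - k + 1) ^ 2 / ((n:ℝ) + 1) ^ 2) := by
        field_simp; ring
      have hp : 0 < (n:ℝ) - 1 - k + 1 := by linarith
      rw [e1, e2, mul_add]
      apply add_le_add
      · refine (exp_neg_le_inv _ (by positivity)).trans (le_of_eq ?_)
        field_simp
      · refine (exp_neg_le_inv _ (by positivity)).trans (le_of_eq ?_)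
        field_simp
    have h1 := Finset.sum_le_sum hterm
    rw [← Finset.mul_sum, Finset.sum_add_distrib,
      Finset.sum_range_reflect (fun k : ℕ => 1 / ((k:ℝ) + 1) ^ 2) n] at h1
    have h2 : ∑ i ∈ Finset.range n, 1 / ((i:ℝ) + 1) ^ 2 ≤ 2 := by
      have := sum_inv_sq_le n
      have : 0 ≤ 1 / ((n:ℝ) + 1 / 2) := by positivity
      linarith
    have h3 : ((n + 1 : ℕ):ℝ) ^ 2 / (4 * t) * (∑ i ∈ Finset.range n, 1 / ((i:ℝ) + 1) ^ 2 +
        ∑ i ∈ Finset.range n, 1 / ((i:ℝ) + 1) ^ 2) ≤ ((n + 1 : ℕ):ℝ) ^ 2 / (4 * t) * (2 + 2) := by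
      gcongr
    have h4 : ((n + 1 : ℕ):ℝ) ^ 2 / (4 * t) * (2 + 2) = ((n + 1 : ℕ):ℝ) ^ 2 / t := by
      field_simp; norm_num
    linarith

lemma EK_large (L : ℕ) (hL : 1 ≤ L) (t : ℝ) (ht : (L:ℝ) ^ 2 ≤ t) :
    |EK L t| ≤ (12 * π ^ 2 + 4 * π ^ 3) * (1 / t) := by
  have hLr : (0:ℝ) < L := by exact_mod_cast hL
  have ht0 : 0 < t := lt_of_lt_of_le (by positivity) ht
  obtain ⟨h1, h2⟩ := SK_bounds L hL t ht0
  have h3 : (L:ℝ) ^ 2 / t ≤ 1 := (div_le_one ht0).2 ht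
  have h4 : SK L t ^ 2 - 1 ≤ 3 * ((L:ℝ) ^ 2 / t) := by nlinarith
  have h5 : 0 ≤ SK L t ^ 2 - 1 := by nlinarith
  have h6 := JK_sq_le t ht0
  unfold EK
  refine (abs_sub _ _).trans ?_
  rw [abs_of_nonneg (by positivity), abs_of_nonneg (by positivity)]
  calc (2 * π / L) ^ 2 * (SK L t ^ 2 - 1) + JK t ^ 2
      ≤ (2 * π / L) ^ 2 * (3 * ((L:ℝ) ^ 2 / t)) + 4 * π ^ 3 / t := by gcongr
    _ = _ := by field_simp; ring

lemma rpow_J_int (l : ℝ) (hl0 : 0 < l) (hl1 : l < 1) :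
    IntegrableOn (fun t : ℝ => t ^ (l - 1) * JK t ^ 2) (Set.Ioi 0) := by
  have hm : Measurable (fun t : ℝ => t ^ (l - 1) * JK t ^ 2) :=
    (measurable_id.pow_const _).mul (JK_cont.measurable.pow_const 2)
  rw [← Set.Ioc_union_Ioi_eq_Ioi (zero_le_one' ℝ)]
  apply IntegrableOn.union
  · have hi : IntegrableOn (fun t : ℝ => t ^ (l - 1) * (2 * π) ^ 2) (Set.Ioc 0 1) := by
      have := (intervalIntegral.intervalIntegrable_rpow' (a := 0) (b := 1) (r := l - 1) (by linarith)).mul_const ((2 * π) ^ 2)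
      rwa [intervalIntegrable_iff_integrableOn_Ioc_of_le zero_le_one] at this
    refine Integrable.mono' hi hm.aestronglyMeasurable ?_
    filter_upwards [ae_restrict_mem measurableSet_Ioc] with t ht
    have h0 : 0 ≤ t ^ (l - 1) := Real.rpow_nonneg ht.1.le _
    rw [Real.norm_of_nonneg (by positivity)]
    exact mul_le_mul_of_nonneg_left (pow_le_pow_left₀ (JK_nonneg t) (JK_le' t ht.1.le) 2) h0
  · have hi : IntegrableOn (fun t : ℝ => t ^ (l - 2) * (4 * π ^ 3)) (Set.Ioi 1) :=
      (integrableOn_Ioi_rpow_of_lt (by linarith) one_pos).mul_const _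
    refine Integrable.mono' hi hm.aestronglyMeasurable ?_
    filter_upwards [ae_restrict_mem measurableSet_Ioi] with t ht
    have ht0 : 0 < t := lt_trans one_pos ht
    have h0 : 0 ≤ t ^ (l - 1) := Real.rpow_nonneg ht0.le _
    rw [Real.norm_of_nonneg (by positivity)]
    refine (mul_le_mul_of_nonneg_left (JK_sq_le t ht0) h0).trans (le_of_eq ?_)
    rw [show l - 2 = l - 1 - 1 by ring, Real.rpow_sub_one ht0.ne' (l - 1)]
    ring

lemma gamma_rep (l : ℝ) (hl0 : 0 < l) (x : ℝ) (hx : 0 ≤ x) :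
    ∫ t in Set.Ioi (0:ℝ), t ^ (l - 1) * Real.exp (-(x * t)) = Real.Gamma l * x ^ (-l) := by
  rcases hx.eq_or_lt with rfl | hx
  · rw [Real.zero_rpow (by linarith)]
    simp only [zero_mul, neg_zero, Real.exp_zero, mul_one, mul_zero]
    exact integral_undef (not_integrableOn_Ioi_rpow _)
  · rw [Real.integral_rpow_mul_exp_neg_mul_Ioi hl0 hx, one_div, Real.inv_rpow hx.le, Real.rpow_neg hx.le]
    ring

lemma gamma_int (l : ℝ) (hl0 : 0 < l) (x : ℝ) (hx : 0 < x) :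
    IntegrableOn (fun t : ℝ => t ^ (l - 1) * Real.exp (-(x * t))) (Set.Ioi 0) := by
  have := integrableOn_rpow_mul_exp_neg_mul_rpow (s := l - 1) (p := 1) (b := x) (by linarith) one_pos hx
  simpa using this

lemma gam_rep (l : ℝ) (hl0 : 0 < l) (hl1 : l < 1) :
    Real.Gamma l * gam l = ∫ t in Set.Ioi (0:ℝ), t ^ (l - 1) * JK t ^ 2 := by
  have h2pi : (0:ℝ) ≤ 2 * π := by positivity
  set μ : Measure ℝ := volume.restrict (Set.Ioc 0 (2 * π)) with hμ
  set ν : Measure ℝ := volume.restrict (Set.Ioi 0) with hν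
  let F : ℝ → ℝ × ℝ → ℝ := fun t p => t ^ (l - 1) * (gK t p.1 * gK t p.2)
  have hFm : Measurable (Function.uncurry F) := by
    have c1 : Continuous (fun q : ℝ × ℝ × ℝ => gK q.1 q.2.1) := by unfold gK; fun_prop
    have c2 : Continuous (fun q : ℝ × ℝ × ℝ => gK q.1 q.2.2) := by unfold gK; fun_prop
    exact (measurable_fst.pow_const _).mul (c1.measurable.mul c2.measurable)
  have gint : ∀ t, Integrable (gK t) μ := fun t =>
    ((gK_cont t).integrableOn_Icc (a := 0) (b := 2 * π)).mono_set Set.Ioc_subset_Icc_self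
  have hFt : ∀ t, ∫ p, F t p ∂(μ.prod μ) = t ^ (l - 1) * JK t ^ 2 := by
    intro t
    simp only [F]
    rw [integral_const_mul, integral_prod_mul (gK t) (gK t)]
    unfold JK
    rw [intervalIntegral.integral_of_le h2pi]
    ring
  have hFi : Integrable (Function.uncurry F) (ν.prod (μ.prod μ)) := by
    rw [integrable_prod_iff hFm.aestronglyMeasurable]
    constructor
    · exact Filter.Eventually.of_forall fun t =>
        ((gint t).mul_prod (gint t)).const_mul (t ^ (l - 1))
    · refine (rpow_J_int l hl0 hl1).congr ?_
      filter_upwards [ae_restrict_mem measurableSet_Ioi] with t ht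
      rw [← hFt t]
      refine integral_congr_ae (Filter.Eventually.of_forall fun p => ?_)
      have ht0 : (0:ℝ) < t := ht
      have : 0 ≤ F t p := mul_nonneg (Real.rpow_nonneg ht0.le _) (mul_pos (gK_pos _ _) (gK_pos _ _)).le
      exact (Real.norm_of_nonneg this).symm
  have hK : ∀ p : ℝ × ℝ, ∫ t, F t p ∂ν =
      Real.Gamma l * (Real.sin (p.1 / 2) ^ 2 + Real.sin (p.2 / 2) ^ 2) ^ (-l) := by
    intro p
    rw [← gamma_rep l hl0 _ (by positivity)]
    refine integral_congr_ae (Filter.Eventually.of_forall fun t => ?_)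
    simp only [F, gK]
    rw [← Real.exp_add]
    congr 2; ring
  have hKi : Integrable (fun p : ℝ × ℝ => Real.Gamma l *
      (Real.sin (p.1 / 2) ^ 2 + Real.sin (p.2 / 2) ^ 2) ^ (-l)) (μ.prod μ) := by
    have := hFi.integral_prod_right
    simpa only [Function.uncurry, hK] using this
  have sw := integral_integral_swap hFi
  simp only [hFt, hK] at sw
  rw [sw, integral_prod _ hKi]
  unfold gam
  rw [intervalIntegral.integral_of_le h2pi, ← integral_const_mul]
  refine integral_congr_ae (Filter.Eventually.of_forall fun s => ?_)
  simp only
  rw [intervalIntegral.integral_of_le h2pi, ← integral_const_mul]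

lemma sum_rep (l : ℝ) (hl0 : 0 < l) (L : ℕ) (hL : 1 ≤ L) :
    IntegrableOn (fun t : ℝ => t ^ (l - 1) * (SK L t ^ 2 - 1)) (Set.Ioi 0) ∧
    Real.Gamma l * riemannSumKer l L = ∫ t in Set.Ioi (0:ℝ), t ^ (l - 1) * (SK L t ^ 2 - 1) := by
  have hLr : (0:ℝ) < L := by exact_mod_cast hL
  let f : ℕ → ℕ → ℝ → ℝ := fun i j t => if (i, j) = (0, 0) then 0 else
    t ^ (l - 1) * Real.exp (-((Real.sin (π * i / L) ^ 2 + Real.sin (π * j / L) ^ 2) * t))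
  have hsin : ∀ i ∈ Finset.range L, i ≠ 0 → 0 < Real.sin (π * i / L) := by
    intro i hi h0
    have hi' : (i:ℝ) < L := by exact_mod_cast Finset.mem_range.1 hi
    have hi0 : (0:ℝ) < i := by exact_mod_cast Nat.pos_of_ne_zero h0
    apply Real.sin_pos_of_pos_of_lt_pi (by positivity)
    rw [div_lt_iff₀ hLr]
    exact mul_lt_mul_of_pos_left hi' Real.pi_pos
  have hpos : ∀ i ∈ Finset.range L, ∀ j ∈ Finset.range L, (i, j) ≠ (0, 0) →
      0 < Real.sin (π * i / L) ^ 2 + Real.sin (π * j / L) ^ 2 := by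
    intro i hi j hj h
    by_cases h0 : i = 0
    · have : j ≠ 0 := by rintro rfl; exact h (by rw [h0])
      have := hsin j hj this
      positivity
    · have := hsin i hi h0
      positivity
  have hfi : ∀ i ∈ Finset.range L, ∀ j ∈ Finset.range L, IntegrableOn (f i j) (Set.Ioi 0) := by
    intro i hi j hj
    by_cases h : (i, j) = (0, 0)
    · simp only [f, h, if_true]; exact integrableOn_zero
    · simp only [f, h, if_false]
      exact gamma_int l hl0 _ (hpos i hi j hj h)
  have hsum : (fun t : ℝ => t ^ (l - 1) * (SK L t ^ 2 - 1)) =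
      fun t => ∑ i ∈ Finset.range L, ∑ j ∈ Finset.range L, f i j t := by
    funext t
    have h1 : ∀ i j : ℕ, f i j t = t ^ (l - 1) * (gK t (2 * π * i / L) * gK t (2 * π * j / L))
        - if i = 0 then (if j = 0 then t ^ (l - 1) else 0) else 0 := by
      intro i j
      have e : ∀ i : ℕ, 2 * π * (i:ℝ) / L / 2 = π * i / L := fun i => by ring
      simp only [f, gK, e, ← Real.exp_add]
      by_cases hi : i = 0
      · by_cases hj : j = 0
        · simp [hi, hj]
        · simp only [hi, hj, Prod.mk.injEq, and_false, if_false, if_true, sub_zero]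
          congr 2; ring
      · simp only [hi, Prod.mk.injEq, false_and, if_false, sub_zero]
        congr 2; ring
    have h0 : 0 ∈ Finset.range L := Finset.mem_range.2 hL
    simp only [h1, Finset.sum_sub_distrib]
    simp only [← Finset.mul_sum, ← Finset.sum_mul]
    have h2 : ∑ i ∈ Finset.range L, ∑ j ∈ Finset.range L,
        (if i = 0 then (if j = 0 then t ^ (l - 1) else 0) else 0) = t ^ (l - 1) := by
      rw [Finset.sum_eq_single 0, Finset.sum_eq_single 0]
      · simp
      · intro j _ hj; simp [hj]
      · intro h; exact absurd h0 h
      · intro i _ hi; simp [hi]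
      · intro h; exact absurd h0 h
    rw [h2]
    unfold SK
    ring
  rw [hsum]
  have hint : ∀ i ∈ Finset.range L, IntegrableOn (fun t => ∑ j ∈ Finset.range L, f i j t) (Set.Ioi 0) :=
    fun i hi => integrable_finsetSum _ (fun j hj => hfi i hi j hj)
  refine ⟨integrable_finsetSum _ hint, ?_⟩
  rw [integral_finsetSum _ hint]
  unfold riemannSumKer
  rw [Finset.mul_sum]
  refine Finset.sum_congr rfl fun i hi => ?_
  rw [integral_finsetSum _ (fun j hj => hfi i hi j hj), Finset.mul_sum]
  refine Finset.sum_congr rfl fun j hj => ?_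
  by_cases h : (i, j) = (0, 0)
  · simp only [f, h, if_true]; simp
  · simp only [f, h, if_false]
    exact (gamma_rep l hl0 _ (hpos i hi j hj h).le).symm

lemma final_bound (l : ℝ) (hl0 : 0 < l) (hl1 : l < 1) (C1 C2 : ℝ) (M : ℝ) (hM : 0 < M)
    (E : ℝ → ℝ) (hE : IntegrableOn (fun t => t ^ (l - 1) * E t) (Set.Ioi 0))
    (h1 : ∀ t, 0 < t → t ≤ M → |E t| ≤ C1 * (1 / M))
    (h2 : ∀ t, M ≤ t → |E t| ≤ C2 * (1 / t)) :
    |∫ t in Set.Ioi (0:ℝ), t ^ (l - 1) * E t| ≤ (C1 / l + C2 / (1 - l)) * M ^ (l - 1) := by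
  rw [← Set.Ioc_union_Ioi_eq_Ioi hM.le] at hE ⊢
  rw [setIntegral_union (Set.Ioc_disjoint_Ioi le_rfl) measurableSet_Ioi
    (hE.mono_set Set.subset_union_left) (hE.mono_set Set.subset_union_right)]
  refine (abs_add_le _ _).trans ?_
  rw [add_mul]
  apply add_le_add
  · have hi : IntegrableOn (fun t : ℝ => t ^ (l - 1) * (C1 * (1 / M))) (Set.Ioc 0 M) := by
      have := (intervalIntegral.intervalIntegrable_rpow' (a := 0) (b := M) (r := l - 1) (by linarith)).mul_const (C1 * (1 / M))
      rwa [intervalIntegrable_iff_integrableOn_Ioc_of_le hM.le] at this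
    have hv : ∫ t in Set.Ioc 0 M, t ^ (l - 1) * (C1 * (1 / M)) = C1 / l * M ^ (l - 1) := by
      rw [← intervalIntegral.integral_of_le hM.le, intervalIntegral.integral_mul_const,
        integral_rpow (Or.inl (by linarith)), Real.rpow_sub_one hM.ne']
      rw [sub_add_cancel, Real.zero_rpow hl0.ne']
      field_simp
      ring
    rw [← hv, ← Real.norm_eq_abs]
    apply norm_integral_le_of_norm_le hi
    filter_upwards [ae_restrict_mem measurableSet_Ioc] with t ht
    rw [norm_mul, Real.norm_of_nonneg (Real.rpow_nonneg ht.1.le _)]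
    exact mul_le_mul_of_nonneg_left (h1 t ht.1 ht.2) (Real.rpow_nonneg ht.1.le _)
  · have hi : IntegrableOn (fun t : ℝ => t ^ (l - 2) * C2) (Set.Ioi M) :=
      (integrableOn_Ioi_rpow_of_lt (by linarith) hM).mul_const _
    have hv : ∫ t in Set.Ioi M, t ^ (l - 2) * C2 = C2 / (1 - l) * M ^ (l - 1) := by
      rw [integral_mul_const, integral_Ioi_rpow_of_lt (by linarith) hM,
        show l - 2 + 1 = -(1 - l) by ring, show l - 1 = -(1 - l) by ring]
      have : 1 - l ≠ 0 := by linarith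
      field_simp
    rw [← hv, ← Real.norm_eq_abs]
    apply norm_integral_le_of_norm_le hi
    filter_upwards [ae_restrict_mem measurableSet_Ioi] with t ht
    have ht' : M < t := ht
    have ht0 : 0 < t := hM.trans ht'
    rw [norm_mul, Real.norm_of_nonneg (Real.rpow_nonneg ht0.le _)]
    refine (mul_le_mul_of_nonneg_left (h2 t ht'.le) (Real.rpow_nonneg ht0.le _)).trans (le_of_eq ?_)
    rw [show l - 2 = l - 1 - 1 by ring, Real.rpow_sub_one ht0.ne' (l - 1)]
    ring

/-- **Riemann-sum approximation of `γ`.** There is `c > 0` (depending only on `λ`)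
such that for every `L ≥ 2`,
`|(4π²/L²) Σ'_{(i,j)} (sin²(πi/L)+sin²(πj/L))^{-λ} - γ| ≤ c L^{2λ-2}`. -/
theorem stmt_17 (l : ℝ) (hl0 : 0 < l) (hl1 : l < 1) :
    ∃ c : ℝ, 0 < c ∧ ∀ L : ℕ, 2 ≤ L →
      |4 * π ^ 2 / (L : ℝ) ^ 2 * riemannSumKer l L - gam l| ≤
        c * (L : ℝ) ^ (2 * l - 2) := by
  obtain ⟨C1, hC1, hA⟩ := EK_small
  have hG : 0 < Real.Gamma l := Real.Gamma_pos_of_pos hl0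
  have hl1' : 0 < 1 - l := by linarith
  set C2 : ℝ := 12 * π ^ 2 + 4 * π ^ 3 with hC2
  have hC2p : 0 < C2 := by positivity
  refine ⟨(C1 / l + C2 / (1 - l)) / Real.Gamma l, by positivity, ?_⟩
  intro L hL2
  have hL : 1 ≤ L := by omega
  have hLr : (0:ℝ) < L := by exact_mod_cast hL
  obtain ⟨hSi, hS⟩ := sum_rep l hl0 L hL
  have hJi := rpow_J_int l hl0 hl1
  have hJ := gam_rep l hl0 hl1
  have hEeq : (fun t : ℝ => t ^ (l - 1) * EK L t) =
      fun t => (2 * π / L) ^ 2 * (t ^ (l - 1) * (SK L t ^ 2 - 1)) - t ^ (l - 1) * JK t ^ 2 := by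
    funext t; unfold EK; ring
  have hEi : IntegrableOn (fun t => t ^ (l - 1) * EK L t) (Set.Ioi 0) := by
    rw [hEeq]; exact (hSi.const_mul _).sub hJi
  have hfin := final_bound l hl0 hl1 C1 C2 ((L:ℝ) ^ 2) (by positivity) (EK L) hEi
    (hA L hL) (fun t ht => EK_large L hL t ht)
  have hval : ∫ t in Set.Ioi (0:ℝ), t ^ (l - 1) * EK L t =
      Real.Gamma l * (4 * π ^ 2 / (L : ℝ) ^ 2 * riemannSumKer l L - gam l) := by
    rw [hEeq, integral_sub (hSi.const_mul _) hJi, integral_const_mul, ← hS, ← hJ]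
    ring
  have hpow : ((L:ℝ) ^ 2) ^ (l - 1) = (L:ℝ) ^ (2 * l - 2) := by
    rw [← Real.rpow_natCast, ← Real.rpow_mul hLr.le]
    congr 1; push_cast; ring
  rw [hval, hpow, abs_mul, abs_of_pos hG] at hfin
  have hrw : (C1 / l + C2 / (1 - l)) / Real.Gamma l * (L:ℝ) ^ (2 * l - 2) =
      (C1 / l + C2 / (1 - l)) * (L:ℝ) ^ (2 * l - 2) / Real.Gamma l := by ring
  rw [hrw, le_div_iff₀ hG]
  linarith
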